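/- Let f₁ > 0, Ȳ ≠ 0, C_x > 0, and let C_y, ρ, λ, g be real numbers with λ·g ≠ 0. If α is a real number with α ≠ (ρ·C_y/C_x)/(λ·g), then f₁·Ȳ²·(C_y² + α²·λ²·g²·C_x² − 2·α·λ·g·ρ·C_y·C_x) > f₁·Ȳ²·C_y²·(1 − ρ²). That is, α_opt = K/(λg) with K = ρC_y/C_x is the unique minimizer of the first-order MSE of the family. -/

import Mathlib

/-- α_opt = (ρC_y/C_x)/(λg) is the unique minimizer: for any other α the
first-order MSE strictly exceeds the minimum f₁·Ȳ²·C_y²·(1 − ρ²). -/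
theorem mse_gt_min_of_ne_opt
    (f₁ Ybar Cx Cy ρ lam g : ℝ) (hf₁ : 0 < f₁) (hY : Ybar ≠ 0) (hCx : 0 < Cx)
    (hlg : lam * g ≠ 0) (α : ℝ) (hα : α ≠ (ρ * Cy / Cx) / (lam * g)) :
    f₁ * Ybar ^ 2 * (Cy ^ 2 + α ^ 2 * lam ^ 2 * g ^ 2 * Cx ^ 2
        - 2 * α * lam * g * ρ * Cy * Cx)
      > f₁ * Ybar ^ 2 * Cy ^ 2 * (1 - ρ ^ 2) := by
  have h : α * (lam * g) * Cx - ρ * Cy ≠ 0 := by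
    intro h
    apply hα
    rw [eq_div_iff hlg, eq_div_iff hCx.ne']
    linarith
  have h2 : 0 < f₁ * Ybar ^ 2 * (α * (lam * g) * Cx - ρ * Cy) ^ 2 := by positivity
  have h3 : f₁ * Ybar ^ 2 * (Cy ^ 2 + α ^ 2 * lam ^ 2 * g ^ 2 * Cx ^ 2
        - 2 * α * lam * g * ρ * Cy * Cx) = f₁ * Ybar ^ 2 * Cy ^ 2 * (1 - ρ ^ 2)
        + f₁ * Ybar ^ 2 * (α * (lam * g) * Cx - ρ * Cy) ^ 2 := by ring
  rw [h3]
  linarith
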